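/- For even n ≥ 4, there is exactly one binary partial word of length n with exactly one hole, located at a position i with 0 ≤ i ≤ n/2 − 1, whose first non-hole character is 0, whose first half (positions 0 through n/2 − 1) contains exactly one occurrence of the letter 0, and whose minimal abelian border length equals n−1; namely, the word 0♦1^{n−2}. -/

import Mathlib

/-- A partial word over alphabet `α` is a list over `Option α`; `none` is a hole. -/
abbrev PWord (α : Type*) := List (Option α)

/-- `c` is a completion of the partial word `w`: a total word of the same length
agreeing with `w` on every non-hole position. -/
def IsCompletion {α : Type*} (w : PWord α) (c : List α) : Prop :=
  List.Forall₂ (fun o a => ∀ x, o = some x → x = a) w c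

/-- Two partial words are abelian compatible if they admit completions that are
permutations of one another (abelian equivalent). -/
def AbelianCompat {α : Type*} (u v : PWord α) : Prop :=
  ∃ cu cv, IsCompletion u cu ∧ IsCompletion v cv ∧ cu.Perm cv

/-- A partial word `w` has an abelian border of length `k`, `1 ≤ k ≤ |w| - 1`, if
its prefix of length `k` is abelian compatible with its suffix of length `k`. -/
def HasAbelianBorder {α : Type*} (w : PWord α) (k : ℕ) : Prop :=
  1 ≤ k ∧ k ≤ w.length - 1 ∧ AbelianCompat (w.take k) (w.drop (w.length - k))

/-- A total word `w` has an abelian border of length `k`, `1 ≤ k ≤ |w| - 1`, if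
its prefix of length `k` is a permutation of its suffix of length `k`. -/
def HasAbelianBorderT {α : Type*} (w : List α) (k : ℕ) : Prop :=
  1 ≤ k ∧ k ≤ w.length - 1 ∧ (w.take k).Perm (w.drop (w.length - k))

/-- The first non-hole character of the binary partial word `w` is the letter `0`:
some position `j` holds the letter `0` and all earlier positions are holes. -/
def FirstLetterIsZero (w : PWord (Fin 2)) : Prop :=
  ∃ j, (∀ l, l < j → w.getD l none = none) ∧ w.getD j none = some 0

theorem IsCompletion.length_eq {α : Type*} {w : PWord α} {c : List α} (h : IsCompletion w c) :
    w.length = c.length :=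
  List.Forall₂.length_eq h

/-- The number of `a`s in a completion lies between the number of letters `a` and the number of
letters `a` plus the number of holes. -/
theorem IsCompletion.count_bounds {α : Type*} [DecidableEq α] {w : PWord α} {c : List α}
    (h : IsCompletion w c) (a : α) :
    w.count (some a) ≤ c.count a ∧
      c.count a ≤ w.count (some a) + w.countP (·.isNone) := by
  induction h with
  | nil => simp
  | @cons o b w c hob _ ih =>
    cases o with
    | none =>
      simp only [List.count_cons, List.countP_cons]
      by_cases hb : b = a <;> simp [hb] <;> omega
    | some x =>
      obtain rfl := hob x rfl
      simp only [List.count_cons, List.countP_cons]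
      by_cases hb : x = a <;> simp [hb] <;> omega

theorem exists_isCompletion_count_zero (w : PWord (Fin 2)) (z : ℕ)
    (hl : w.count (some 0) ≤ z) (hu : z ≤ w.count (some 0) + w.countP (·.isNone)) :
    ∃ c, IsCompletion w c ∧ c.count 0 = z := by
  induction w generalizing z with
  | nil => exact ⟨[], List.Forall₂.nil, by simp at hl hu ⊢; omega⟩
  | cons o w ih =>
    cases o with
    | none =>
      simp at hl hu
      by_cases hz : w.count (some 0) < z
      · obtain ⟨c, hc, hcz⟩ := ih (z - 1) (by omega) (by omega)
        exact ⟨0 :: c, List.Forall₂.cons (by simp) hc, by simp [hcz]; omega⟩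
      · obtain ⟨c, hc, hcz⟩ := ih z (by omega) (by omega)
        exact ⟨1 :: c, List.Forall₂.cons (by simp) hc, by simp [hcz]⟩
    | some x =>
      by_cases hx : x = 0
      · subst hx
        simp at hl hu
        obtain ⟨c, hc, hcz⟩ := ih (z - 1) (by omega) (by omega)
        exact ⟨0 :: c, List.Forall₂.cons (by simp) hc, by simp [hcz]; omega⟩
      · simp [hx] at hl hu
        obtain ⟨c, hc, hcz⟩ := ih z (by omega) (by omega)
        exact ⟨x :: c, List.Forall₂.cons (by simp) hc, by simp [hcz, hx]⟩

theorem count_zero_add_count_one (c : List (Fin 2)) : c.count 0 + c.count 1 = c.length := by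
  induction c with
  | nil => simp
  | cons a c ih => fin_cases a <;> simp <;> omega

/-- Binary partial words of equal length are abelian compatible iff the ranges of the number of
`0`s in their completions intersect. -/
theorem abelianCompat_iff_count_zero {u v : PWord (Fin 2)} (h : u.length = v.length) :
    AbelianCompat u v ↔
      u.count (some 0) ≤ v.count (some 0) + v.countP (·.isNone) ∧
        v.count (some 0) ≤ u.count (some 0) + u.countP (·.isNone) := by
  constructor
  · rintro ⟨cu, cv, hu, hv, hp⟩
    have h1 := hu.count_bounds 0
    have h2 := hv.count_bounds 0
    have h3 := hp.count_eq 0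
    omega
  · rintro ⟨h1, h2⟩
    obtain ⟨cu, hu, hcu⟩ := exists_isCompletion_count_zero u
      (max (u.count (some 0)) (v.count (some 0))) (by omega) (by omega)
    obtain ⟨cv, hv, hcv⟩ := exists_isCompletion_count_zero v
      (max (u.count (some 0)) (v.count (some 0))) (by omega) (by omega)
    refine ⟨cu, cv, hu, hv, List.perm_iff_count.2 fun a => ?_⟩
    have h3 := count_zero_add_count_one cu
    have h4 := count_zero_add_count_one cv
    have h5 := hu.length_eq
    have h6 := hv.length_eq
    fin_cases a
    · exact hcu.trans hcv.symm
    · change cu.count 1 = cv.count 1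
      omega

theorem hasAbelianBorder_iff_count_zero {w : PWord (Fin 2)} {k : ℕ} :
    HasAbelianBorder w k ↔ 1 ≤ k ∧ k ≤ w.length - 1 ∧
      (w.take k).count (some 0) ≤
        (w.drop (w.length - k)).count (some 0) + (w.drop (w.length - k)).countP (·.isNone) ∧
      (w.drop (w.length - k)).count (some 0) ≤
        (w.take k).count (some 0) + (w.take k).countP (·.isNone) := by
  unfold HasAbelianBorder
  refine and_congr_right fun _ => and_congr_right fun _ => abelianCompat_iff_count_zero ?_
  simp
  omega

theorem isLeast_abelianBorder_zero_hole_ones {n : ℕ} (hn : 4 ≤ n) :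
    IsLeast {k | HasAbelianBorder (some 0 :: none :: List.replicate (n - 2) (some (1 : Fin 2))) k}
      (n - 1) := by
  obtain ⟨m, rfl⟩ : ∃ m, n = m + 2 := ⟨n - 2, by omega⟩
  simp only [Nat.add_sub_cancel]
  refine ⟨?_, fun k hk => ?_⟩
  · obtain ⟨p, rfl⟩ : ∃ p, m = p + 1 := ⟨m - 1, by omega⟩
    rw [Set.mem_ofPred_eq, hasAbelianBorder_iff_count_zero]
    simp [List.count_replicate, List.take_replicate, List.countP_replicate]
  · rw [Set.mem_ofPred_eq, hasAbelianBorder_iff_count_zero] at hk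
    obtain ⟨h1, h2, h3, -⟩ := hk
    by_contra hlt
    obtain ⟨j, rfl⟩ : ∃ j, k = j + 1 := ⟨k - 1, by omega⟩
    obtain ⟨d, hd⟩ : ∃ d, m + 1 + 1 - (j + 1) = d + 2 := ⟨m - 1 - j, by omega⟩
    simp [hd, List.count_replicate, List.countP_replicate] at h3

/-- If a word starts with `0`, contains no other `0` among its first `m` positions, and has no
abelian border of length at most `m`, then its last `m` positions contain no `0`. -/
theorem count_zero_suffix_eq_zero {w : PWord (Fin 2)} {m : ℕ} (hm : m < w.length)
    (hZ : ∀ k, 1 ≤ k → k ≤ m → (w.take k).count (some 0) = 1)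
    (hB : ∀ k ≤ m, ¬ HasAbelianBorder w k) :
    (w.drop (w.length - m)).count (some 0) = 0 := by
  suffices ∀ k ≤ m, (w.drop (w.length - k)).count (some 0) = 0 from this m le_rfl
  intro k hk
  induction k with
  | zero => simp
  | succ k ih =>
    have h0 := ih (by omega)
    have hdrop : w.drop (w.length - (k + 1)) =
        w[w.length - (k + 1)] :: w.drop (w.length - k) := by
      rw [List.drop_eq_getElem_cons (by omega)]
      congr 2
      omega
    have hle : (w.drop (w.length - (k + 1))).count (some 0) ≤ 1 := by
      rw [hdrop, List.count_cons, h0]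
      split <;> omega
    have hb := hB (k + 1) hk
    have hz := hZ (k + 1) (by omega) hk
    rw [hasAbelianBorder_iff_count_zero] at hb
    omega

theorem eq_replicate_one {t : PWord (Fin 2)} (hz : t.count (some 0) = 0)
    (hh : t.countP (·.isNone) = 0) : t = List.replicate t.length (some 1) := by
  rw [List.eq_replicate_iff]
  refine ⟨rfl, fun b hb => ?_⟩
  have h1 := List.count_eq_zero.1 hz
  have h2 := List.countP_eq_zero.1 hh b hb
  rcases b with _ | b
  · simp at h2
  · fin_cases b
    · exact absurd hb h1
    · rfl

/-- For even `n ≥ 4`, there is exactly one binary partial word of length `n` with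
exactly one hole located at a position `i ≤ n/2 - 1`, whose first non-hole character
is `0`, with exactly one occurrence of the letter `0` in the first half, and with
minimal abelian border length `n - 1`; namely `0♦1^(n-2)`. -/
theorem stmt_15 (n : ℕ) (hn : 4 ≤ n) (he : Even n) :
    ∀ w : PWord (Fin 2),
      (w.length = n ∧ w.countP (·.isNone) = 1 ∧
        (∃ i, i ≤ n / 2 - 1 ∧ w.getD i (some 0) = none) ∧
        FirstLetterIsZero w ∧
        (w.take (n / 2)).count (some 0) = 1 ∧
        IsLeast {k | HasAbelianBorder w k} (n - 1)) ↔
      w = some 0 :: none :: List.replicate (n - 2) (some 1) := by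
  obtain ⟨m, rfl⟩ := he
  have hhalf : (m + m) / 2 = m := by omega
  rw [hhalf]
  intro w
  constructor
  · rintro ⟨hlen, hhole, ⟨i, hi, hwi⟩, hfirst, hcount, hleast⟩
    have hB : ∀ k, HasAbelianBorder w k → m + m - 1 ≤ k := fun k hk => hleast.2 hk
    have hil : i < w.length := by omega
    rw [List.getD_eq_getElem _ _ hil] at hwi
    obtain ⟨t, rfl⟩ : ∃ t, w = some 0 :: t := by
      rcases w with _ | ⟨o, t⟩
      · simp at hil
      rcases o with _ | x
      · have hb : HasAbelianBorder (none :: t) 1 := by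
          rw [hasAbelianBorder_iff_count_zero]
          refine ⟨le_rfl, by omega, by simp, ?_⟩
          refine List.count_le_length.trans ?_
          simp
        have := hB 1 hb
        omega
      · obtain ⟨j, hj, hj0⟩ := hfirst
        rcases j with _ | j
        · exact ⟨t, by simpa using hj0⟩
        · simpa using hj 0 (by omega)
    have hZ : ∀ k, 1 ≤ k → k ≤ m → ((some 0 :: t).take k).count (some 0) = 1 := by
      intro k hk hkm
      refine le_antisymm (le_of_le_of_eq ?_ hcount) ?_
      · exact (List.take_sublist_take_left hkm).count_le _
      · obtain ⟨k, rfl⟩ : ∃ j, k = j + 1 := ⟨k - 1, by omega⟩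
        simp
    have hS := count_zero_suffix_eq_zero (by omega) hZ
      fun k hk hb => by have := hB k hb; omega
    have htot : t.count (some 0) = 0 := by
      have h := List.count_append (a := some 0) (l₁ := (some 0 :: t).take m)
        (l₂ := (some 0 :: t).drop m)
      rw [List.take_append_drop, hcount] at h
      rw [hlen, Nat.add_sub_cancel] at hS
      rw [hS] at h
      simpa using h
    obtain ⟨i, rfl⟩ : ∃ j, i = j + 1 := by
      rcases i with _ | i
      · simp at hwi
      · exact ⟨i, rfl⟩
    have hmem : (none : Option (Fin 2)) ∈ (some 0 :: t).drop (i + 1) := by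
      rw [List.drop_eq_getElem_cons hil, hwi]
      exact List.mem_cons_self
    have hpos : 1 ≤ ((some 0 :: t).drop (i + 1)).countP (·.isNone) :=
      List.countP_pos_iff.2 ⟨none, hmem, rfl⟩
    have hb : HasAbelianBorder (some 0 :: t) (m + m - (i + 1)) := by
      rw [hasAbelianBorder_iff_count_zero, hlen,
        show m + m - (m + m - (i + 1)) = i + 1 by omega]
      have h1 : ((some 0 :: t).take (m + m - (i + 1))).count (some 0) ≤ 1 := by
        refine ((List.take_sublist _ _).count_le _).trans ?_
        simp [htot]
      have h2 : ((some 0 :: t).drop (i + 1)).count (some 0) = 0 := by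
        have := (List.drop_sublist i t).count_le (some 0)
        simp only [List.drop_succ_cons]
        omega
      omega
    have hi0 := hB _ hb
    obtain rfl : i = 0 := by omega
    rcases t with _ | ⟨o, t⟩
    · simp at hil
    obtain rfl : o = none := by simpa using hwi
    have hl : t.length = m + m - 2 := by simp at hlen; omega
    rw [← hl, ← eq_replicate_one (by simpa using htot) (by simpa using hhole)]
  · intro hw
    have hleast := isLeast_abelianBorder_zero_hole_ones hn
    rw [← hw] at hleast
    refine ⟨?_, ?_, ⟨1, by omega, ?_⟩, ⟨0, by simp, ?_⟩, ?_, hleast⟩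
    · simp [hw]; omega
    · simp [hw, List.countP_replicate]
    · simp [hw]
    · simp [hw]
    · obtain ⟨p, rfl⟩ : ∃ p, m = p + 2 := ⟨m - 2, by omega⟩
      simp [hw, List.count_replicate, List.take_replicate]
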